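/- arXiv:1409.3782 — 3 statements merged into one kernel-verified Lean document; each statement's English description precedes it below -/
import Mathlib

section
/- Let k ≥ 1 be an integer and let ξ ∈ ℂ be a primitive 2k-th root of unity. Then the radial limit lim_{t→0⁺} ( f(ξe^{-t}) − (−1)^k b(ξe^{-t}) ) exists and equals −4 ∑_{n=0}^{k−1} (−ξ;ξ)_n² ξ^{n+1}. -/
open scoped BigOperators Classical
open Filter Topology

noncomputable section

/-- finite q-Pochhammer symbol $(x;q)_n$ -/
def qPoch (x q : ℂ) (n : ℕ) : ℂ := ∏ j ∈ Finset.range n, (1 - x * q ^ j)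

/-- infinite q-Pochhammer symbol $(x;q)_\infty$ -/
def qPochInf (x q : ℂ) : ℂ := ∏' j : ℕ, (1 - x * q ^ j)

/-- $e(x) = e^{2\pi i x}$ -/
def ee (x : ℂ) : ℂ := Complex.exp (2 * Real.pi * Complex.I * x)

/-- $\zeta_n^m = e(m/n)$ -/
def zeta (m : ℤ) (n : ℕ) : ℂ := ee ((m : ℂ) / (n : ℂ))

/-- Dedekind eta -/
def eta (τ : ℂ) : ℂ := Complex.exp (Real.pi * Complex.I * τ / 12) * qPochInf (ee τ) (ee τ)

/-- Jacobi theta -/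
def theta (z τ : ℂ) : ℂ :=
  -Complex.I * Complex.exp (Real.pi * Complex.I * τ / 4) * Complex.exp (-(Real.pi * Complex.I * z))
    * qPochInf (ee τ) (ee τ) * qPochInf (ee z) (ee τ) * qPochInf ((ee z)⁻¹ * ee τ) (ee τ)

/-- universal mock theta function g₂ -/
def g2 (ζ q : ℂ) : ℂ :=
  ∑' n : ℕ, qPoch (-q) q n * q ^ (n * (n + 1) / 2) /
    (qPoch ζ q (n + 1) * qPoch (ζ⁻¹ * q) q (n + 1))

/-- universal mock theta function g₃ -/
def g3 (ζ q : ℂ) : ℂ :=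
  ∑' n : ℕ, q ^ (n * (n + 1)) / (qPoch ζ q (n + 1) * qPoch (ζ⁻¹ * q) q (n + 1))

/-- the series L -/
def Lser (ζ q : ℂ) : ℂ :=
  (1 / 2) * ∑' n : ℕ, q ^ n * qPoch (ζ⁻¹ * q) q n * qPoch ζ q n / qPoch (-q) q n

/-- the function M -/
def Mfun (z τ : ℂ) : ℂ :=
  -(Complex.I / 2) * Complex.exp (Real.pi * Complex.I * z) * theta z τ *
    g3 (-(ee z)) (ee τ) / (Complex.exp (Real.pi * Complex.I * τ / 12) * eta (2 * τ))

/-- the function T -/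
def Tfun (z τ : ℂ) : ℂ :=
  -Complex.I * eta (2 * τ) ^ 4 / (ee z * eta τ ^ 2 * theta (2 * z) (2 * τ))
  - Complex.I * eta (2 * τ) ^ 10 * theta (2 * z + 1 / 2) (2 * τ) /
      (2 * ee z ^ 2 * Complex.exp (Real.pi * Complex.I * τ / 2) * eta τ ^ 4 * eta (4 * τ) ^ 4 *
        theta (2 * z) (2 * τ) * theta (2 * z + τ + 1 / 2) (2 * τ))
  - Complex.I * eta (2 * τ) ^ 4 * theta z τ /
      (2 * Complex.exp (Real.pi * Complex.I * τ / 2) * ee z ^ 2 * eta (4 * τ) ^ 2 *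
        theta (z + 1 / 2) τ * theta (2 * z + τ + 1 / 2) (2 * τ))

/-- the function K -/
def Kfun (z τ : ℂ) : ℂ :=
  eta (2 * τ) ^ 4 / (Complex.I * ee z * eta τ ^ 2 * theta (2 * z) (2 * τ))

/-- Zwegers' μ-function -/
def mu (z₁ z₂ τ : ℂ) : ℂ :=
  Complex.exp (Real.pi * Complex.I * z₁) / theta z₂ τ *
    ∑' n : ℤ, (-(ee z₂)) ^ n * Complex.exp (Real.pi * Complex.I * (n : ℂ) * ((n : ℂ) + 1) * τ) /
      (1 - ee z₁ * (ee τ) ^ n)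

/-- the Appell–Lerch sum A -/
def appell (ζ q : ℂ) : ℂ :=
  ∑' n : ℤ, (-1 : ℂ) ^ n * q ^ ((3 * n * (n + 1)) / 2) / (1 + ζ * q ^ n)

/-- the function Θ -/
def bigTheta (z₁ z₂ z τ : ℂ) : ℂ :=
  (1 / (2 * Real.pi * Complex.I)) * deriv (fun w => theta w τ) 0 *
    theta (z₁ + z₂ + z) τ * theta z τ /
    (theta z₁ τ * theta z₂ τ * theta (z₁ + z) τ * theta (z₂ + z) τ)

/-- the function 𝔱 -/
def tfrak (z τ : ℂ) : ℂ :=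
  Kfun z τ - Complex.I * Kfun (z + 1 / 4) (τ + 1 / 2) +
    Complex.I * Complex.exp (-(Real.pi * Complex.I * τ / 2)) * bigTheta (2 * z) τ (1 / 2) (2 * τ)

/-- the second order mock theta function B -/
def mockB (q : ℂ) : ℂ :=
  ∑' n : ℕ, q ^ n * qPoch (-q) (q ^ 2) n / qPoch q (q ^ 2) (n + 1)

/-- Ramanujan's third order mock theta function f -/
def mockf (q : ℂ) : ℂ := ∑' n : ℕ, q ^ (n ^ 2) / qPoch (-q) q n ^ 2

/-- the modular form b -/
def bfun (q : ℂ) : ℂ := qPochInf q q / qPochInf (-q) q ^ 2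

/-- τ(t) = h/k + it/(2π) -/
def tauT (h k : ℕ) (t : ℝ) : ℂ := (h : ℂ) / (k : ℂ) + Complex.I * (t : ℂ) / (2 * Real.pi)

/-- q(t) = e^{2πiτ(t)} -/
def qT (h k : ℕ) (t : ℝ) : ℂ := ee (tauT h k t)

/-- Fine's function `∑ tⁿ / (bq;q)ₙ`. -/
def fineF (b t q : ℂ) : ℂ := ∑' n : ℕ, t ^ n / ∏ j ∈ Finset.range n, (1 - b * q ^ (j + 1))

/-- General term of the series `oddSeries`. -/
def oddTerm (t q : ℂ) (m : ℕ) : ℂ :=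
  (-1) ^ m * q ^ ((m + 1) ^ 2) / ∏ j ∈ Finset.range (m + 1), (1 - t * q ^ (2 * j + 1))

/-- The series `∑ (-1)ᵐ q^((m+1)²) / (tq;q²)ₘ₊₁`. -/
def oddSeries (t q : ℂ) : ℂ := ∑' m : ℕ, oddTerm t q m

lemma one_sub_mul_pow_ne_zero {x q : ℂ} (hq : ‖q‖ < 1) (hx : ‖x‖ ≤ 1) (n : ℕ) :
    1 - x * q ^ (n + 1) ≠ 0 := by
  intro h
  have h1 : ‖x * q ^ (n + 1)‖ = 1 := by rw [← sub_eq_zero.mp h, norm_one]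
  have h2 : ‖q‖ ^ (n + 1) < 1 := pow_lt_one₀ (norm_nonneg _) hq (by omega)
  rw [norm_mul, norm_pow] at h1
  nlinarith [norm_nonneg x, pow_nonneg (norm_nonneg q) (n + 1)]

lemma tendsto_one_sub_mul_pow {q : ℂ} (hq : ‖q‖ < 1) (x : ℂ) (e : ℕ → ℕ)
    (he : Tendsto e atTop atTop) :
    Tendsto (fun n => 1 - x * q ^ e n) atTop (𝓝 1) := by
  have := ((tendsto_pow_atTop_nhds_zero_of_norm_lt_one hq).comp he).const_mul x
  simpa using this.const_sub 1

lemma summable_fineF {b t q : ℂ} (hq : ‖q‖ < 1) (ht : ‖t‖ < 1) :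
    Summable fun n : ℕ => t ^ n / ∏ j ∈ Finset.range n, (1 - b * q ^ (j + 1)) := by
  obtain ⟨ρ, h1, h2⟩ := exists_between ht
  refine summable_of_ratio_norm_eventually_le h2 ?_
  have hlim : Tendsto (fun n : ℕ => ‖t / (1 - b * q ^ (n + 1))‖) atTop (𝓝 ‖t‖) := by
    have := (tendsto_const_nhds (x := t)).div
      (tendsto_one_sub_mul_pow hq b (fun n => n + 1) (tendsto_add_atTop_nat 1)) one_ne_zero
    simpa using this.norm
  filter_upwards [hlim.eventually (eventually_lt_nhds h1)] with n hn
  rw [Finset.prod_range_succ, pow_succ, mul_div_mul_comm, norm_mul, mul_comm]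
  gcongr

lemma oddTerm_succ (t q : ℂ) (m : ℕ) :
    oddTerm t q (m + 1) = oddTerm t q m * (-q ^ (2 * m + 3) / (1 - t * q ^ (2 * m + 3))) := by
  unfold oddTerm
  rw [Finset.prod_range_succ _ (m + 1), div_mul_div_comm]
  congr 1
  ring

lemma summable_oddTerm {q : ℂ} (hq : ‖q‖ < 1) (t : ℂ) : Summable (oddTerm t q) := by
  refine summable_of_ratio_norm_eventually_le (r := 1 / 2) (by norm_num) ?_
  have he : Tendsto (fun m : ℕ => 2 * m + 3) atTop atTop :=
    tendsto_atTop_mono (fun m => show m ≤ _ by omega) tendsto_id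
  have hlim : Tendsto (fun m : ℕ => ‖-q ^ (2 * m + 3) / (1 - t * q ^ (2 * m + 3))‖) atTop
      (𝓝 0) := by
    have := (((tendsto_pow_atTop_nhds_zero_of_norm_lt_one hq).comp he).neg).div
      (tendsto_one_sub_mul_pow hq t _ he) one_ne_zero
    simpa using this.norm
  filter_upwards [hlim.eventually (eventually_lt_nhds (by norm_num : (0 : ℝ) < 1 / 2))] with n hn
  rw [oddTerm_succ, norm_mul, mul_comm]
  gcongr

/-- The `b`-shift of Fine's function. -/
lemma fineF_shift_left {b t q : ℂ} (hq : ‖q‖ < 1) (ht : ‖t‖ < 1) :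
    fineF b t q = 1 + t / (1 - b * q) * fineF (b * q) t q := by
  unfold fineF
  rw [(summable_fineF hq ht).tsum_eq_zero_add, ← tsum_mul_left]
  simp only [pow_zero, Finset.range_zero, Finset.prod_empty, div_one]
  congr 2
  ext n
  rw [Finset.prod_range_succ', div_mul_div_comm, pow_succ']
  congr 1
  simp only [zero_add, pow_one]
  rw [mul_comm]
  congr 1
  exact Finset.prod_congr rfl fun j _ => by ring

/-- The `t`-shift of Fine's function. -/
lemma fineF_shift_right {b t q : ℂ} (hq : ‖q‖ < 1) (ht : ‖t‖ < 1)
    (hb : ∀ n : ℕ, 1 - b * q ^ (n + 1) ≠ 0) :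
    (1 - t) * fineF b t q = 1 - b + b * fineF b (t * q) q := by
  have htq : ‖t * q‖ < 1 := by
    rw [norm_mul]; nlinarith [norm_nonneg t, norm_nonneg q]
  have h0 := (summable_fineF (b := b) hq ht)
  have h1 := (summable_fineF (b := b) hq htq)
  have key : fineF b t q - 1 - t * fineF b t q = b * (fineF b (t * q) q - 1) := by
    unfold fineF
    rw [← tsum_mul_left, h1.tsum_eq_zero_add]
    conv_lhs => rw [h0.tsum_eq_zero_add]
    simp only [pow_zero, Finset.range_zero, Finset.prod_empty, div_one, add_sub_cancel_left]
    rw [← ((summable_nat_add_iff 1).mpr h0).tsum_sub (h0.mul_left t), ← tsum_mul_left]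
    congr 1
    ext n
    rw [Finset.prod_range_succ]
    have hP : ∏ j ∈ Finset.range n, (1 - b * q ^ (j + 1)) ≠ 0 :=
      Finset.prod_ne_zero_iff.mpr fun j _ => hb j
    have := hb n
    field_simp
    ring
  linear_combination key

/-- The second order shift of `oddSeries`, valid also for `‖q‖ = 1`. -/
lemma oddSeries_shift {t q : ℂ} (h0 : Summable (oddTerm t q))
    (hne : ∀ n : ℕ, 1 - t * q ^ (2 * n + 1) ≠ 0) :
    oddSeries (t * q ^ 2) q = t * q + (1 - t) * (1 - t * q) * oddSeries t q := by
  set w : ℕ → ℂ := fun m => (1 - t * q) * oddTerm t q m with hw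
  have hw0 : w 0 = q := by
    have := hne 0
    simp only [hw, oddTerm]
    simp at this ⊢
    field_simp
  have hterm : ∀ m, oddTerm (t * q ^ 2) q m = w m / (1 - t * q ^ (2 * m + 3)) := by
    intro m
    have e1 : ∏ j ∈ Finset.range (m + 2), (1 - t * q ^ (2 * j + 1)) =
        (∏ j ∈ Finset.range (m + 1), (1 - t * q ^ 2 * q ^ (2 * j + 1))) * (1 - t * q) := by
      rw [Finset.prod_range_succ']
      congr 1
      · exact Finset.prod_congr rfl fun j _ => by ring
      · simp
    have e2 := Finset.prod_range_succ (fun j => 1 - t * q ^ (2 * j + 1)) (m + 1)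
    rw [e1] at e2
    have n0 := hne 0
    simp at n0
    have n1 := hne (m + 1)
    have n2 : ∏ j ∈ Finset.range (m + 1), (1 - t * q ^ (2 * j + 1)) ≠ 0 :=
      Finset.prod_ne_zero_iff.mpr fun j _ => hne j
    have e3 : 2 * (m + 1) + 1 = 2 * m + 3 := by ring
    rw [e3] at n1 e2
    have n3 : ∏ j ∈ Finset.range (m + 1), (1 - t * q ^ 2 * q ^ (2 * j + 1)) ≠ 0 := by
      intro h; rw [h, zero_mul] at e2; exact mul_ne_zero n2 n1 e2.symm
    simp only [hw, oddTerm]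
    rw [mul_div_assoc', div_div, ← e2, mul_comm (∏ j ∈ Finset.range (m + 1), _) (1 - t * q),
      mul_div_mul_left _ _ n0]
  have hstep : ∀ m, oddTerm (t * q ^ 2) q m =
      (1 - t) * w m + (t * w m - t * w (m + 1)) := by
    intro m
    have n1 := hne (m + 1)
    have e3 : 2 * (m + 1) + 1 = 2 * m + 3 := by ring
    rw [e3] at n1
    have : w (m + 1) = w m * (-q ^ (2 * m + 3) / (1 - t * q ^ (2 * m + 3))) := by
      simp only [hw, oddTerm_succ]; ring
    rw [hterm, this]
    field_simp
    ring
  have hws : Summable w := h0.mul_left _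
  have hws1 : Summable fun m => w (m + 1) := (summable_nat_add_iff 1).mpr hws
  have htel : ∑' m, (t * w m - t * w (m + 1)) = t * q := by
    have a0 : ∑' m, t * w m = t * ∑' m, w m := tsum_mul_left
    have a1 : ∑' m, t * w (m + 1) = t * ∑' m, w (m + 1) := tsum_mul_left
    rw [(hws.mul_left t).tsum_sub (hws1.mul_left t), a0, a1, hws.tsum_eq_zero_add, hw0]
    ring
  have : oddSeries (t * q ^ 2) q = ∑' m, ((1 - t) * w m + (t * w m - t * w (m + 1))) := by
    unfold oddSeries; exact tsum_congr hstep
  rw [this, (hws.mul_left _).tsum_add ((hws.mul_left t).sub (hws1.mul_left t)), htel, tsum_mul_left]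
  simp only [hw, tsum_mul_left, oddSeries]
  ring

/-- Ramanujan's `f` in terms of Fine's function. -/
lemma mockf_eq_fineF {q : ℂ} (hq : ‖q‖ < 1) : mockf q = 2 - fineF (-1) (-q) q := by
  set K : ℕ → ℂ := fun n => 1 + q ^ n - q ^ n * fineF (-q ^ n) (-q ^ (n + 1)) q with hK
  have hne : ∀ n : ℕ, 1 + q ^ (n + 1) ≠ 0 := fun n => by
    simpa using one_sub_mul_pow_ne_zero (x := -1) hq (by simp) n
  have hpow : ∀ n : ℕ, ‖-q ^ (n + 1)‖ < 1 := fun n => by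
    rw [norm_neg, norm_pow]; exact pow_lt_one₀ (norm_nonneg _) hq (by omega)
  have hstep : ∀ n, K n = 1 + q ^ (2 * n + 1) / (1 + q ^ (n + 1)) ^ 2 * K (n + 1) := by
    intro n
    have e1 := fineF_shift_left (b := -q ^ n) hq (hpow n)
    have e2 := fineF_shift_right (b := -q ^ n * q) hq (hpow n) (fun m => by
      have := hne (n + 1 + m)
      convert this using 1; ring)
    simp only [hK]
    rw [e1]
    have e3 : -q ^ n * q = -q ^ (n + 1) := by ring
    have e4 : -q ^ (n + 1) * q = -q ^ (n + 1 + 1) := by ring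
    rw [e3, e4] at e2
    rw [e3]
    have := hne n
    have e5 : fineF (-q ^ (n + 1)) (-q ^ (n + 1)) q =
      (1 + q ^ (n + 1) - q ^ (n + 1) * fineF (-q ^ (n + 1)) (-q ^ (n + 1 + 1)) q) /
        (1 + q ^ (n + 1)) := by
      rw [eq_div_iff this]; linear_combination e2
    rw [e5, sub_neg_eq_add]
    field_simp
    ring
  set u : ℕ → ℂ := fun n => q ^ (n ^ 2) / qPoch (-q) q n ^ 2 with hu
  have husucc : ∀ n, u (n + 1) = u n * (q ^ (2 * n + 1) / (1 + q ^ (n + 1)) ^ 2) := by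
    intro n
    simp only [hu, qPoch]
    rw [Finset.prod_range_succ, div_mul_div_comm, mul_pow]
    congr 1 <;> ring
  have hsum : Summable u := by
    refine summable_of_ratio_norm_eventually_le (r := 1 / 2) (by norm_num) ?_
    have he : Tendsto (fun m : ℕ => 2 * m + 1) atTop atTop :=
      tendsto_atTop_mono (fun m => show m ≤ _ by omega) tendsto_id
    have hlim : Tendsto (fun m : ℕ => ‖q ^ (2 * m + 1) / (1 + q ^ (m + 1)) ^ 2‖) atTop
        (𝓝 0) := by
      have := ((tendsto_pow_atTop_nhds_zero_of_norm_lt_one hq).comp he).div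
        ((tendsto_one_sub_mul_pow hq (-1) _ (tendsto_add_atTop_nat 1)).pow 2) (by simp)
      simpa using this.norm
    filter_upwards [hlim.eventually (eventually_lt_nhds (by norm_num : (0 : ℝ) < 1 / 2))] with n hn
    rw [husucc, norm_mul, mul_comm]
    gcongr
  have hpart : ∀ N, K 0 = ∑ n ∈ Finset.range N, u n + u N * K N := by
    intro N
    induction N with
    | zero => simp [hu, qPoch]
    | succ N ih => rw [ih, Finset.sum_range_succ, husucc, hstep N]; ring
  have hKb : ∀ᶠ n in atTop, ‖K n‖ ≤ 4 := by
    have hz : Tendsto (fun n : ℕ => ‖q‖ ^ n) atTop (𝓝 0) :=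
      tendsto_pow_atTop_nhds_zero_of_lt_one (norm_nonneg _) hq
    filter_upwards [hz.eventually (eventually_le_nhds (by norm_num : (0 : ℝ) < 1 / 3))] with n hn
    have hm : ∀ m : ℕ, ‖q‖ ^ (n + m) ≤ 1 / 3 := fun m =>
      (pow_le_pow_of_le_one (norm_nonneg _) hq.le (by omega)).trans hn
    have hF : ‖fineF (-q ^ n) (-q ^ (n + 1)) q‖ ≤ 2 := by
      refine tsum_of_norm_bounded hasSum_geometric_two fun m => ?_
      rw [norm_div, norm_pow, norm_prod, norm_neg, norm_pow]
      have h1 : (2 / 3 : ℝ) ^ m ≤ ∏ j ∈ Finset.range m, ‖1 - -q ^ n * q ^ (j + 1)‖ := by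
        calc (2 / 3 : ℝ) ^ m = ∏ j ∈ Finset.range m, (2 / 3 : ℝ) := by
              rw [Finset.prod_const, Finset.card_range]
          _ ≤ _ := by
            refine Finset.prod_le_prod (fun _ _ => by norm_num) fun j _ => ?_
            have h2 := norm_sub_norm_le (1 : ℂ) (-q ^ n * q ^ (j + 1))
            rw [norm_one, norm_mul, norm_neg, norm_pow, norm_pow, ← pow_add] at h2
            linarith [hm (j + 1)]
      calc (‖q‖ ^ (n + 1)) ^ m / _ ≤ (1 / 3 : ℝ) ^ m / (2 / 3 : ℝ) ^ m := by
            gcongr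
            exact hm 1
        _ = (1 / 2) ^ m := by rw [← div_pow]; norm_num
    have h3 : ‖K n‖ ≤ ‖(1 : ℂ)‖ + ‖q ^ n‖ + ‖q ^ n * fineF (-q ^ n) (-q ^ (n + 1)) q‖ :=
      (norm_sub_le _ _).trans (by gcongr; exact norm_add_le _ _)
    rw [norm_mul, norm_pow, norm_one] at h3
    nlinarith [pow_nonneg (norm_nonneg q) n, norm_nonneg (fineF (-q ^ n) (-q ^ (n + 1)) q)]
  have hrem : Tendsto (fun N => u N * K N) atTop (𝓝 0) := by
    have := hsum.tendsto_atTop_zero.norm.mul_const 4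
    rw [norm_zero, zero_mul] at this
    refine squeeze_zero_norm' ?_ this
    filter_upwards [hKb] with N hN
    rw [norm_mul]
    gcongr
  have hlim := hsum.hasSum.tendsto_sum_nat.add hrem
  simp only [← hpart, add_zero] at hlim
  have h0 := tendsto_nhds_unique hlim tendsto_const_nhds
  have : mockf q = ∑' n, u n := rfl
  rw [this, h0]
  simp [hK]
  ring

/-- The difference of Fine's function and twice the odd series; up to a constant it is
`1 / (t;q)_∞`. -/
def fineDiff (t q : ℂ) : ℂ := fineF (-1) t q - 2 * oddSeries t q

lemma fineDiff_shift {t q : ℂ} (hq : ‖q‖ < 1) (ht : ‖t‖ < 1) :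
    fineDiff (t * q ^ 2) q = (1 - t) * (1 - t * q) * fineDiff t q := by
  have htq : ‖t * q‖ < 1 := by
    rw [norm_mul]; nlinarith [norm_nonneg t, norm_nonneg q]
  have hb := one_sub_mul_pow_ne_zero (x := -1) hq (by simp)
  have e1 := fineF_shift_right hq ht hb
  have e2 := fineF_shift_right hq htq hb
  have e3 := oddSeries_shift (summable_oddTerm hq t)
    (fun n => one_sub_mul_pow_ne_zero hq ht.le (2 * n))
  have e4 : t * q * q = t * q ^ 2 := by ring
  rw [e4] at e2
  unfold fineDiff
  linear_combination e2 - 2 * e3 - (1 - t * q) * e1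

lemma fineDiff_iterate {t q : ℂ} (hq : ‖q‖ < 1) (ht : ‖t‖ < 1) (n : ℕ) :
    fineDiff (t * q ^ (2 * n)) q = fineDiff t q * ∏ j ∈ Finset.range (2 * n), (1 - t * q ^ j) := by
  induction n with
  | zero => simp
  | succ n ih =>
    have hn : ‖t * q ^ (2 * n)‖ < 1 := by
      rw [norm_mul, norm_pow]
      have := pow_le_one₀ (n := 2 * n) (norm_nonneg q) hq.le
      nlinarith [norm_nonneg t, pow_nonneg (norm_nonneg q) (2 * n)]
    have := fineDiff_shift hq hn
    rw [show 2 * (n + 1) = 2 * n + 1 + 1 by ring, Finset.prod_range_succ, Finset.prod_range_succ]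
    rw [show t * q ^ (2 * n + 1 + 1) = t * q ^ (2 * n) * q ^ 2 by ring, this, ih]
    ring

lemma norm_one_sub_le {x q : ℂ} (hx : ‖x‖ ≤ 1) (n : ℕ) :
    1 - ‖q‖ ^ n ≤ ‖1 - x * q ^ n‖ := by
  have h2 := norm_sub_norm_le (1 : ℂ) (x * q ^ n)
  rw [norm_one, norm_mul, norm_pow] at h2
  nlinarith [pow_nonneg (norm_nonneg q) n]

lemma tendsto_fineF_zero {b q : ℂ} (hq : ‖q‖ < 1) {s : ℕ → ℂ} (hs : Tendsto s atTop (𝓝 0)) :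
    Tendsto (fun n => fineF b (s n) q) atTop (𝓝 (fineF b 0 q)) := by
  have h2 : ∀ᶠ n in atTop, ‖s n‖ ≤ 1 / 2 :=
    (by simpa using hs.norm : Tendsto (fun n => ‖s n‖) atTop (𝓝 0)).eventually
      (eventually_le_nhds (by norm_num))
  refine tendsto_tsum_of_dominated_convergence
    (summable_fineF (b := b) (t := 1 / 2) hq (by norm_num)).norm ?_ ?_
  · intro m
    exact (hs.pow m).div_const _
  · filter_upwards [h2] with n hn m
    rw [norm_div, norm_div, norm_pow, norm_pow]
    gcongr
    simpa using hn

lemma tendsto_oddSeries_zero {q : ℂ} (hq : ‖q‖ < 1) {s : ℕ → ℂ} (hs : Tendsto s atTop (𝓝 0)) :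
    Tendsto (fun n => oddSeries (s n) q) atTop (𝓝 (oddSeries 0 q)) := by
  have h2 : ∀ᶠ n in atTop, ‖s n‖ ≤ 1 :=
    (by simpa using hs.norm : Tendsto (fun n => ‖s n‖) atTop (𝓝 0)).eventually
      (eventually_le_nhds (by norm_num))
  have hq' : ‖(‖q‖ : ℂ)‖ < 1 := by simpa using hq
  have hpos : ∀ j : ℕ, 0 < 1 - ‖q‖ ^ (j + 1) := fun j =>
    sub_pos.mpr (pow_lt_one₀ (norm_nonneg _) hq (by omega))
  refine tendsto_tsum_of_dominated_convergence (summable_oddTerm hq' 1).norm ?_ ?_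
  · intro m
    unfold oddTerm
    refine tendsto_const_nhds.div (tendsto_finsetProd _ fun j _ => ?_) (by simp)
    exact tendsto_const_nhds.sub (hs.mul_const _)
  · filter_upwards [h2] with n hn m
    unfold oddTerm
    have e : ∏ j ∈ Finset.range (m + 1), (1 - (1 : ℂ) * (‖q‖ : ℂ) ^ (2 * j + 1)) =
        ((∏ j ∈ Finset.range (m + 1), (1 - ‖q‖ ^ (2 * j + 1)) : ℝ) : ℂ) := by
      push_cast; simp
    have hp : 0 < ∏ j ∈ Finset.range (m + 1), (1 - ‖q‖ ^ (2 * j + 1)) :=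
      Finset.prod_pos fun j _ => hpos (2 * j)
    rw [e, norm_div, norm_div, Complex.norm_real, Real.norm_of_nonneg hp.le, norm_prod]
    simp only [norm_mul, norm_pow, norm_neg, norm_one, one_pow, one_mul, Complex.norm_real,
      norm_norm]
    gcongr
    · exact fun j _ => (hpos (2 * j)).le
    · exact norm_one_sub_le hn _

lemma multipliable_qPoch {x q : ℂ} (hq : ‖q‖ < 1) :
    Multipliable fun j : ℕ => 1 - x * q ^ j := by
  have := multipliable_one_add_of_summable (f := fun j : ℕ => -(x * q ^ j))
    (by simpa [norm_mul] using (summable_geometric_of_lt_one (norm_nonneg q) hq).mul_left ‖x‖)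
  simpa [sub_eq_add_neg] using this

lemma tendsto_qPoch {x q : ℂ} (hq : ‖q‖ < 1) :
    Tendsto (qPoch x q) atTop (𝓝 (qPochInf x q)) :=
  (multipliable_qPoch hq).tendsto_prod_tprod_nat

lemma qPochInf_ne_zero {x q : ℂ} (hq : ‖q‖ < 1) (hx : ‖x‖ < 1) : qPochInf x q ≠ 0 := by
  have := tprod_one_add_ne_zero_of_summable (f := fun j : ℕ => -(x * q ^ j)) (fun j h => by
      have h1 : ‖x * q ^ j‖ = 1 := by
        rw [show x * q ^ j = 1 by linear_combination -h, norm_one]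
      rw [norm_mul, norm_pow] at h1
      have := pow_le_one₀ (n := j) (norm_nonneg q) hq.le
      nlinarith [norm_nonneg x, pow_nonneg (norm_nonneg q) j])
    (by simpa [norm_mul] using (summable_geometric_of_lt_one (norm_nonneg q) hq).mul_left ‖x‖)
  simpa [qPochInf, sub_eq_add_neg] using this

lemma fineDiff_mul_qPochInf {t q : ℂ} (hq : ‖q‖ < 1) (ht : ‖t‖ < 1) :
    fineDiff t q * qPochInf t q = fineDiff 0 q := by
  have h2 : Tendsto (fun n : ℕ => 2 * n) atTop atTop :=
    tendsto_atTop_mono (fun m => show m ≤ _ by omega) tendsto_id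
  have hs : Tendsto (fun n : ℕ => t * q ^ (2 * n)) atTop (𝓝 0) := by
    simpa using ((tendsto_pow_atTop_nhds_zero_of_norm_lt_one hq).comp h2).const_mul t
  have l1 : Tendsto (fun n : ℕ => fineDiff (t * q ^ (2 * n)) q) atTop (𝓝 (fineDiff 0 q)) :=
    (tendsto_fineF_zero hq hs).sub ((tendsto_oddSeries_zero hq hs).const_mul 2)
  have l2 := ((tendsto_qPoch (x := t) hq).comp h2).const_mul (fineDiff t q)
  refine tendsto_nhds_unique l2 (l1.congr fun n => ?_)
  simp [fineDiff_iterate hq ht, qPoch]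

lemma fineF_self {q : ℂ} (hq : ‖q‖ < 1) : fineF (-1) q q = 2 - 1 / qPochInf (-q) q := by
  have hs := summable_fineF (b := -1) hq hq
  have hP : ∀ n, ∏ j ∈ Finset.range n, (1 - -1 * q ^ (j + 1)) = qPoch (-q) q n := fun n =>
    Finset.prod_congr rfl fun j _ => by ring
  have hne : ∀ n, qPoch (-q) q n ≠ 0 := fun n => by
    rw [← hP]
    exact Finset.prod_ne_zero_iff.mpr fun j _ => one_sub_mul_pow_ne_zero hq (by simp) j
  have hpart : ∀ n, ∑ m ∈ Finset.range (n + 1),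
      q ^ m / ∏ j ∈ Finset.range m, (1 - -1 * q ^ (j + 1)) = 2 - 1 / qPoch (-q) q n := by
    intro n
    induction n with
    | zero => simp [qPoch]; norm_num
    | succ n ih =>
      rw [Finset.sum_range_succ, ih, hP]
      have h0 := hne n
      have h1 := hne (n + 1)
      have h2 : qPoch (-q) q (n + 1) = qPoch (-q) q n * (1 + q ^ (n + 1)) := by
        unfold qPoch; rw [Finset.prod_range_succ]; ring
      rw [h2] at h1 ⊢
      have h3 := right_ne_zero_of_mul h1
      field_simp
      ring
  have l1 := hs.hasSum.tendsto_sum_nat.comp (tendsto_add_atTop_nat 1)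
  have l2 : Tendsto (fun n => 2 - 1 / qPoch (-q) q n) atTop (𝓝 (2 - 1 / qPochInf (-q) q)) :=
    (tendsto_const_nhds.div (tendsto_qPoch hq) (qPochInf_ne_zero hq (by simpa using hq))).const_sub 2
  exact tendsto_nhds_unique l1 (l2.congr fun n => (hpart n).symm)

lemma fineDiff_neg {q : ℂ} (hq : ‖q‖ < 1) : fineDiff (-q) q = bfun q := by
  have hq2 : ‖q ^ 2‖ < 1 := by rw [norm_pow]; exact pow_lt_one₀ (norm_nonneg _) hq two_ne_zero
  have hb := one_sub_mul_pow_ne_zero (x := -1) hq (by simp)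
  have hP := qPochInf_ne_zero (x := -q) hq (by simpa using hq)
  have e1 := fineF_shift_right hq hq hb
  rw [fineF_self hq] at e1
  have e2 := oddSeries_shift (t := 1) (summable_oddTerm hq _)
    (fun n => one_sub_mul_pow_ne_zero hq (by simp) (2 * n))
  have e3 : fineDiff (q ^ 2) q = (1 - q) / qPochInf (-q) q := by
    simp only [one_mul, sub_self, zero_mul, add_zero] at e2
    rw [← pow_two] at e1
    unfold fineDiff
    rw [e2]
    linear_combination e1
  have e4 := fineDiff_mul_qPochInf hq hq2
  have e5 := fineDiff_mul_qPochInf (t := -q) hq (by simpa using hq)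
  have e6 : qPochInf q q = (1 - q) * qPochInf (q ^ 2) q := by
    refine tendsto_nhds_unique ((tendsto_qPoch hq).comp (tendsto_add_atTop_nat 1))
      (((tendsto_qPoch (x := q ^ 2) hq).const_mul (1 - q)).congr fun n => ?_)
    simp only [qPoch, Function.comp]
    rw [Finset.prod_range_succ', mul_comm]
    congr 1
    · exact Finset.prod_congr rfl fun j _ => by ring
    · ring
  rw [e3] at e4
  rw [bfun, eq_div_iff (pow_ne_zero 2 hP), e6]
  have e7 : fineDiff (-q) q * qPochInf (-q) q =
      (1 - q) / qPochInf (-q) q * qPochInf (q ^ 2) q := by rw [e5, e4]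
  rw [pow_two, ← mul_assoc, e7]
  field_simp

/-- Watson's relation `f + b = 2φ(-q)`. -/
lemma mockf_add_bfun {q : ℂ} (hq : ‖q‖ < 1) :
    mockf q + bfun q = 2 - 2 * oddSeries (-q) q := by
  rw [mockf_eq_fineF hq, ← fineDiff_neg hq, fineDiff]
  ring

/-- Watson's relation `f - b = -4ψ(-q)`. -/
lemma mockf_sub_bfun {q : ℂ} (hq : ‖q‖ < 1) :
    mockf q - bfun q = 4 * oddSeries (-1) q := by
  have hq' : ‖-q‖ < 1 := by simpa using hq
  have hb := one_sub_mul_pow_ne_zero (x := -1) hq (by simp)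
  have hP := qPochInf_ne_zero (x := -q) hq hq'
  have hq2 : ‖-q * q‖ < 1 := by
    rw [norm_mul]; nlinarith [norm_nonneg (-q), norm_nonneg q]
  have e1 := fineF_shift_right hq hq' hb
  have e2 := oddSeries_shift (t := -1) (summable_oddTerm hq _)
    (fun n => one_sub_mul_pow_ne_zero hq (by simp) (2 * n))
  have e3 := fineDiff_mul_qPochInf hq hq'
  have e4 := fineDiff_mul_qPochInf hq hq2
  have e5 : qPochInf (-q) q = (1 + q) * qPochInf (-q * q) q := by
    refine tendsto_nhds_unique ((tendsto_qPoch hq).comp (tendsto_add_atTop_nat 1))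
      (((tendsto_qPoch (x := -q * q) hq).const_mul (1 + q)).congr fun n => ?_)
    simp only [qPoch, Function.comp]
    rw [Finset.prod_range_succ', mul_comm]
    congr 1
    · exact Finset.prod_congr rfl fun j _ => by ring
    · ring
  have e6 : fineDiff (-q * q) q = (1 + q) * fineDiff (-q) q := by
    refine mul_right_cancel₀ (qPochInf_ne_zero hq hq2) ?_
    rw [e4, ← e3, e5]; ring
  have hq1 : 1 + q ≠ 0 := by simpa using hb 0
  rw [mockf_eq_fineF hq, ← fineDiff_neg hq]
  refine mul_left_cancel₀ hq1 ?_
  have e7 : (-1 : ℂ) * q ^ 2 = -q * q := by ring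
  rw [e7] at e2
  have e8 : fineF (-1) (-q * q) q = fineDiff (-q * q) q + 2 * oddSeries (-q * q) q := by
    rw [fineDiff]; ring
  rw [e8, e2, e6] at e1
  linear_combination -e1

lemma IsPrimitiveRoot.pow_half_eq_neg_one {k : ℕ} (hk : 1 ≤ k) {ξ : ℂ}
    (hξ : IsPrimitiveRoot ξ (2 * k)) : ξ ^ k = -1 := by
  have h1 : (ξ ^ k) ^ 2 = 1 := by rw [← pow_mul, mul_comm, hξ.pow_eq_one]
  rw [pow_two] at h1
  refine (mul_self_eq_one_iff.mp h1).resolve_left ?_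
  exact hξ.pow_ne_one_of_pos_of_lt (by omega) (by omega)

lemma IsPrimitiveRoot.one_add_pow_ne_zero {k : ℕ} (hk : 1 ≤ k) {ξ : ℂ}
    (hξ : IsPrimitiveRoot ξ (2 * k)) {n : ℕ} (hn : Odd (n + k)) : 1 + ξ ^ n ≠ 0 := by
  intro h
  have h1 : ξ ^ (n + k) = 1 := by
    rw [pow_add, hξ.pow_half_eq_neg_one hk]; linear_combination -h
  have h2 : 2 ∣ n + k := (Dvd.intro _ rfl).trans (hξ.dvd_of_pow_eq_one _ h1)
  exact (Nat.not_even_iff_odd.mpr hn) (even_iff_two_dvd.mpr h2)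

lemma IsPrimitiveRoot.prod_one_sub_pow_mul {ζ : ℂ} {k : ℕ} (hk : 0 < k)
    (hζ : IsPrimitiveRoot ζ k) (y : ℂ) :
    ∏ j ∈ Finset.range k, (1 - ζ ^ j * y) = 1 - y ^ k := by
  have h := hζ.pow_sub_pow_eq_prod_sub_mul 1 y hk
  rw [one_pow] at h
  rw [h]
  refine Finset.prod_bij (fun j _ => ζ ^ j) ?_ ?_ ?_ ?_
  · intro j _
    rw [Polynomial.mem_nthRootsFinset hk, ← pow_mul, mul_comm, pow_mul, hζ.pow_eq_one, one_pow]
  · intro i hi j hj hij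
    exact hζ.pow_inj (Finset.mem_range.mp hi) (Finset.mem_range.mp hj) hij
  · intro x hx
    have : NeZero k := ⟨hk.ne'⟩
    obtain ⟨i, hi, rfl⟩ := hζ.eq_pow_of_pow_eq_one ((Polynomial.mem_nthRootsFinset hk _).mp hx)
    exact ⟨i, Finset.mem_range.mpr hi, rfl⟩
  · exact fun _ _ => rfl

lemma eventually_lt_norm_block {k : ℕ} (hk : 1 ≤ k) {ξ : ℂ} (hξ : IsPrimitiveRoot ξ (2 * k))
    {e : ℕ} (he : Even (e + k)) :
    ∀ᶠ q in 𝓝 ξ, ∀ w ∈ {w : ℂ | ‖w‖ ≤ 1 ∧ w ^ k = (‖w‖ : ℂ) ^ k},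
      3 / 2 * ‖w‖ ^ k < ‖∏ j ∈ Finset.range k, (1 + w * q ^ (2 * j + 3 + e))‖ := by
  have hcomp : IsCompact {w : ℂ | ‖w‖ ≤ 1 ∧ w ^ k = (‖w‖ : ℂ) ^ k} := by
    refine Metric.isCompact_of_isClosed_isBounded ?_ ?_
    · exact (isClosed_le continuous_norm continuous_const).inter
        (isClosed_eq (by fun_prop) (by fun_prop))
    · exact (Metric.isBounded_closedBall (x := (0 : ℂ)) (r := 1)).subset
        fun w hw => by simpa using hw.1
  refine hcomp.eventually_forall_of_forall_eventually fun w hw => ?_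
  have hval : ∏ j ∈ Finset.range k, (1 + w * ξ ^ (2 * j + 3 + e)) = 1 + w ^ k := by
    have h2 : IsPrimitiveRoot (ξ ^ 2) k := hξ.pow (by omega) rfl
    have h3 := h2.prod_one_sub_pow_mul (by omega) (-(w * ξ ^ (3 + e)))
    have h4 : (-(w * ξ ^ (3 + e))) ^ k = - w ^ k := by
      rw [neg_pow, mul_pow, ← pow_mul, mul_comm (3 + e) k, pow_mul, hξ.pow_half_eq_neg_one hk]
      have h5 : (-1 : ℂ) ^ k * (-1) ^ (3 + e) = -1 := by
        rw [← pow_add]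
        refine Odd.neg_one_pow ?_
        obtain ⟨c, hc⟩ := he
        exact ⟨c + 1, by omega⟩
      linear_combination w ^ k * h5
    rw [h4, sub_neg_eq_add] at h3
    rw [← h3]
    exact Finset.prod_congr rfl fun j _ => by ring
  have hcont : Continuous fun z : ℂ × ℂ =>
      ‖∏ j ∈ Finset.range k, (1 + z.2 * z.1 ^ (2 * j + 3 + e))‖ - 3 / 2 * ‖z.2‖ ^ k := by
    fun_prop
  have hpos : 0 < ‖∏ j ∈ Finset.range k, (1 + w * ξ ^ (2 * j + 3 + e))‖ - 3 / 2 * ‖w‖ ^ k := by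
    rw [hval, hw.2]
    have h6 : (1 : ℂ) + (‖w‖ : ℂ) ^ k = ((1 + ‖w‖ ^ k : ℝ) : ℂ) := by push_cast; rfl
    have h7 := pow_nonneg (norm_nonneg w) k
    have h8 := pow_le_one₀ (n := k) (norm_nonneg w) hw.1
    rw [h6, Complex.norm_real, Real.norm_of_nonneg (by positivity)]
    linarith
  filter_upwards [(hcont.tendsto (ξ, w)).eventually (eventually_gt_nhds hpos)] with z hz
  linarith

lemma oddTerm_add (e k m : ℕ) (q : ℂ) :
    oddTerm (-q ^ e) q (m + k) = oddTerm (-q ^ e) q m *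
      ((-1) ^ k * q ^ (2 * m * k + 2 * k + k ^ 2) /
        ∏ j ∈ Finset.range k, (1 + q ^ (2 * m) * q ^ (2 * j + 3 + e))) := by
  unfold oddTerm
  rw [show m + k + 1 = (m + 1) + k by ring, Finset.prod_range_add, div_mul_div_comm]
  congr 1
  · ring
  · congr 1
    exact Finset.prod_congr rfl fun j _ => by ring

lemma continuousAt_oddTerm {k : ℕ} (hk : 1 ≤ k) {ξ : ℂ} (hξ : IsPrimitiveRoot ξ (2 * k))
    {e : ℕ} (he : Even (e + k)) (m : ℕ) :
    ContinuousAt (fun q => oddTerm (-q ^ e) q m) ξ := by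
  unfold oddTerm
  refine ContinuousAt.div (by fun_prop) (by fun_prop) ?_
  refine Finset.prod_ne_zero_iff.mpr fun j _ => ?_
  have := hξ.one_add_pow_ne_zero hk (n := e + (2 * j + 1)) (by
    obtain ⟨c, hc⟩ := he
    exact ⟨c + j, by omega⟩)
  rwa [neg_mul, sub_neg_eq_add, ← pow_add]

lemma exists_geometric_bound_oddTerm {k : ℕ} (hk : 1 ≤ k) {ξ : ℂ}
    (hξ : IsPrimitiveRoot ξ (2 * k)) {e : ℕ} (he : Even (e + k)) :
    ∃ C ρ : ℝ, 0 ≤ ρ ∧ ρ < 1 ∧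
      ∀ᶠ q in 𝓝[{q | ∃ r : ℝ, 0 ≤ r ∧ r ≤ 1 ∧ q = ξ * r}] ξ,
        ∀ m, ‖oddTerm (-q ^ e) q m‖ ≤ C * ρ ^ m := by
  have hk' : (1 : ℝ) ≤ k := by exact_mod_cast hk
  obtain ⟨ρ, h0, h1, hρ⟩ : ∃ ρ : ℝ, 0 < ρ ∧ ρ < 1 ∧ 2 / 3 ≤ ρ ^ k := by
    have hle : (1 : ℝ) / (3 * k) ≤ 1 / 3 := by
      apply one_div_le_one_div_of_le <;> linarith
    have hpos : (0 : ℝ) < 1 / (3 * k) := by positivity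
    refine ⟨1 - 1 / (3 * k), by linarith, by linarith, ?_⟩
    have := one_add_mul_le_pow (a := -(1 / (3 * (k : ℝ)))) (by linarith) k
    rw [← sub_eq_add_neg] at this
    refine le_trans (le_of_eq ?_) this
    field_simp
    norm_num
  set B : ℝ := ∑ m ∈ Finset.range k, (‖oddTerm (-ξ ^ e) ξ m‖ + 1) with hB
  have hB0 : ∀ m < k, ‖oddTerm (-ξ ^ e) ξ m‖ < B := by
    intro m hm
    have := Finset.single_le_sum (f := fun m => ‖oddTerm (-ξ ^ e) ξ m‖ + 1)
      (fun i _ => by positivity) (Finset.mem_range.mpr hm)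
    exact (lt_add_one _).trans_le this
  have hBpos : 0 ≤ B := Finset.sum_nonneg fun i _ => by positivity
  have hbase : ∀ᶠ q in 𝓝 ξ, ∀ m ∈ Finset.range k, ‖oddTerm (-q ^ e) q m‖ < B := by
    rw [Filter.eventually_all_finset]
    intro m hm
    exact (continuousAt_oddTerm hk hξ he m).norm.eventually
      (eventually_lt_nhds (hB0 m (Finset.mem_range.mp hm)))
  refine ⟨B / ρ ^ k, ρ, h0.le, h1, ?_⟩
  filter_upwards [nhdsWithin_le_nhds hbase, nhdsWithin_le_nhds (eventually_lt_norm_block hk hξ he),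
    self_mem_nhdsWithin] with q hq1 hq2 ⟨r, hr0, hr1, hqr⟩
  have hnq : ‖q‖ = r := by
    rw [hqr, norm_mul, hξ.norm'_eq_one (by omega), Complex.norm_real, Real.norm_of_nonneg hr0,
      one_mul]
  have hstep : ∀ m, ‖oddTerm (-q ^ e) q (m + k)‖ ≤ 2 / 3 * ‖oddTerm (-q ^ e) q m‖ := by
    intro m
    have hw := hq2 (q ^ (2 * m)) ⟨by
        rw [norm_pow, hnq]; exact pow_le_one₀ hr0 hr1, by
        rw [norm_pow, hnq, hqr, ← pow_mul, mul_pow,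
          show 2 * m * k = 2 * k * m by ring, pow_mul ξ, hξ.pow_eq_one, one_pow, one_mul,
          show 2 * k * m = 2 * m * k by ring, pow_mul, Complex.ofReal_pow]⟩
    rw [oddTerm_add, norm_mul, mul_comm]
    gcongr
    rw [norm_div, norm_mul, norm_pow, norm_neg, norm_one, one_pow, one_mul, norm_pow]
    have h3 : ‖q‖ ^ (2 * m * k + 2 * k + k ^ 2) ≤ ‖q ^ (2 * m)‖ ^ k := by
      rw [norm_pow, hnq, ← pow_mul]
      exact pow_le_pow_of_le_one hr0 hr1 (by omega)
    have h4 : 0 ≤ ‖q ^ (2 * m)‖ ^ k := by positivity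
    rw [div_le_iff₀ (by linarith)]
    linarith
  intro m
  induction m using Nat.strong_induction_on with
  | _ m ih =>
    rcases lt_or_ge m k with hm | hm
    · refine (hq1 m (Finset.mem_range.mpr hm)).le.trans ?_
      rw [div_mul_eq_mul_div, le_div_iff₀ (by positivity)]
      exact mul_le_mul_of_nonneg_left (pow_le_pow_of_le_one h0.le h1.le hm.le) hBpos
    · obtain ⟨n, rfl⟩ := Nat.exists_eq_add_of_le' hm
      refine (hstep n).trans ?_
      have h5 := ih n (by omega)
      have h6 : 0 ≤ B / ρ ^ k * ρ ^ n := by positivity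
      calc 2 / 3 * ‖oddTerm (-q ^ e) q n‖ ≤ ρ ^ k * (B / ρ ^ k * ρ ^ n) := by gcongr
        _ = B / ρ ^ k * ρ ^ (n + k) := by ring

lemma summable_oddTerm_root {k : ℕ} (hk : 1 ≤ k) {ξ : ℂ} (hξ : IsPrimitiveRoot ξ (2 * k))
    {e : ℕ} (he : Even (e + k)) : Summable (oddTerm (-ξ ^ e) ξ) := by
  obtain ⟨C, ρ, h0, h1, h⟩ := exists_geometric_bound_oddTerm hk hξ he
  exact ((summable_geometric_of_lt_one h0 h1).mul_left C).of_norm_bounded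
    (h.self_of_nhdsWithin ⟨1, by norm_num, le_rfl, by simp⟩)

lemma tendsto_oddSeries_root {k : ℕ} (hk : 1 ≤ k) {ξ : ℂ} (hξ : IsPrimitiveRoot ξ (2 * k))
    {e : ℕ} (he : Even (e + k)) :
    Tendsto (fun q => oddSeries (-q ^ e) q) (𝓝[{q | ∃ r : ℝ, 0 ≤ r ∧ r ≤ 1 ∧ q = ξ * r}] ξ)
      (𝓝 (oddSeries (-ξ ^ e) ξ)) := by
  obtain ⟨C, ρ, h0, h1, h⟩ := exists_geometric_bound_oddTerm hk hξ he
  exact tendsto_tsum_of_dominated_convergence ((summable_geometric_of_lt_one h0 h1).mul_left C)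
    (fun m => (continuousAt_oddTerm hk hξ he m).tendsto.mono_left nhdsWithin_le_nhds) h

lemma oddSeries_root_shift {k : ℕ} (hk : 1 ≤ k) {ξ : ℂ} (hξ : IsPrimitiveRoot ξ (2 * k))
    {e : ℕ} (he : Even (e + k)) :
    oddSeries (-ξ ^ (e + 2)) ξ =
      -ξ ^ (e + 1) + (1 + ξ ^ e) * (1 + ξ ^ (e + 1)) * oddSeries (-ξ ^ e) ξ := by
  have h := oddSeries_shift (summable_oddTerm_root hk hξ he) (fun n => by
    have := hξ.one_add_pow_ne_zero hk (n := e + (2 * n + 1)) (by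
      obtain ⟨c, hc⟩ := he
      exact ⟨c + n, by omega⟩)
    rwa [neg_mul, sub_neg_eq_add, ← pow_add])
  rw [show -ξ ^ (e + 2) = -ξ ^ e * ξ ^ 2 by ring, h]
  ring

/-- The values at `-ξ ^ j` of the common limit of Fine's function corrected by `± 1 / (t;q)_∞`. -/
def rootValue (k : ℕ) (ξ : ℂ) (j : ℕ) : ℂ :=
  if Even (j + k) then 2 * oddSeries (-ξ ^ j) ξ
  else 2 - (1 + ξ ^ (j - 1)) * (2 * oddSeries (-ξ ^ (j - 1)) ξ)

lemma rootValue_succ {k : ℕ} (hk : 1 ≤ k) {ξ : ℂ} (hξ : IsPrimitiveRoot ξ (2 * k))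
    {j : ℕ} (hj : 1 ≤ j) :
    rootValue k ξ (j + 1) = 2 - (1 + ξ ^ j) * rootValue k ξ j := by
  by_cases h : Even (j + k)
  · have h' : ¬ Even (j + 1 + k) := by
      rw [show j + 1 + k = j + k + 1 by ring, Nat.even_add_one]; exact not_not.mpr h
    simp [rootValue, h, h']
  · have h' : Even (j + 1 + k) := by
      rw [show j + 1 + k = j + k + 1 by ring, Nat.even_add_one]; exact h
    obtain ⟨i, rfl⟩ := Nat.exists_eq_add_of_le' hj
    have hi : Even (i + k) := by
      rw [show i + 1 + k = i + k + 1 by ring, Nat.even_add_one, not_not] at h; exact h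
    simp only [rootValue, h, h', if_true, if_false, Nat.add_sub_cancel]
    rw [show i + 1 + 1 = i + 2 by ring, oddSeries_root_shift hk hξ hi]
    ring

lemma rootValue_add {k : ℕ} (hk : 1 ≤ k) {ξ : ℂ} (hξ : IsPrimitiveRoot ξ (2 * k)) (n : ℕ) :
    rootValue k ξ (k + 1 + n) = 2 * ∑ m ∈ Finset.range (n + 1),
      (-1) ^ m * ∏ i ∈ Finset.range m, (1 + ξ ^ (k + n - i)) := by
  induction n with
  | zero =>
    rw [add_zero, rootValue_succ hk hξ hk, hξ.pow_half_eq_neg_one hk]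
    simp
  | succ n ih =>
    rw [← add_assoc, rootValue_succ hk hξ (by omega), ih, Finset.sum_range_succ' _ (n + 1)]
    have : ∀ m, ∏ i ∈ Finset.range (m + 1), (1 + ξ ^ (k + (n + 1) - i)) =
        (1 + ξ ^ (k + 1 + n)) * ∏ i ∈ Finset.range m, (1 + ξ ^ (k + n - i)) := by
      intro m
      rw [Finset.prod_range_succ', mul_comm]
      congr 1
      · rw [Nat.sub_zero]; congr 2; ring
      · refine Finset.prod_congr rfl fun i _ => ?_
        rw [show k + (n + 1) - (i + 1) = k + n - i by omega]
    simp only [this, pow_succ, Finset.range_zero, Finset.prod_empty, pow_zero]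
    rw [mul_add, Finset.mul_sum, Finset.mul_sum, Finset.mul_sum, sub_eq_add_neg, add_comm, mul_one,
      mul_one, ← Finset.sum_neg_distrib]
    congr 1
    exact Finset.sum_congr rfl fun m _ => by ring

lemma sum_prod_shift (B t p : ℂ) (hp : p ≠ 0) (M : ℕ) :
    (1 - t / p) * ∑ m ∈ Finset.range M,
        (t / p) ^ m * ∏ i ∈ Finset.range m, (1 - B * p ^ (i + 1)) =
      1 - t * B * ∑ m ∈ Finset.range M, t ^ m * ∏ i ∈ Finset.range m, (1 - B * p ^ (i + 1)) -
        (t / p) ^ M * ∏ i ∈ Finset.range M, (1 - B * p ^ (i + 1)) := by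
  obtain ⟨x, rfl⟩ : ∃ x, t = x * p := ⟨t / p, (div_mul_cancel₀ t hp).symm⟩
  rw [mul_div_cancel_right₀ x hp]
  induction M with
  | zero => simp
  | succ M ih =>
    rw [Finset.sum_range_succ, Finset.sum_range_succ, Finset.prod_range_succ, mul_add, ih]
    ring

/-- Truncated form of `∑ tᵐ (-p^(j+1);p)ₘ` at `p = ξ⁻¹`, `t = -ξ^j`. -/
def rootSum (k : ℕ) (ξ : ℂ) (j : ℕ) : ℂ :=
  ∑ m ∈ Finset.range (k - j), (-ξ ^ j) ^ m * ∏ i ∈ Finset.range m, (1 + ξ⁻¹ ^ (j + (i + 1)))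

lemma rootSum_step {k : ℕ} (hk : 1 ≤ k) {ξ : ℂ} (hξ : IsPrimitiveRoot ξ (2 * k))
    {j : ℕ} (hj : j < k) :
    rootSum k ξ j = -ξ ^ (j + 1) + (1 + ξ ^ (j + 1)) ^ 2 * rootSum k ξ (j + 1) := by
  have h0 : ξ ≠ 0 := hξ.ne_zero (by omega)
  have h1 := sum_prod_shift (-ξ⁻¹ ^ j) (-ξ ^ j) ξ⁻¹ (inv_ne_zero h0) (k - j)
  obtain ⟨M, hM⟩ : ∃ M, k - j = M + 1 := ⟨k - j - 1, by omega⟩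
  have hM' : k - (j + 1) = M := by omega
  have hprod : ∀ m, ∏ i ∈ Finset.range m, (1 - -ξ⁻¹ ^ j * ξ⁻¹ ^ (i + 1)) =
      ∏ i ∈ Finset.range m, (1 + ξ⁻¹ ^ (j + (i + 1))) := fun m =>
    Finset.prod_congr rfl fun i _ => by ring
  have hzero : ∏ i ∈ Finset.range (M + 1), (1 + ξ⁻¹ ^ (j + (i + 1))) = 0 := by
    refine Finset.prod_eq_zero (Finset.mem_range.mpr (Nat.lt_succ_self M)) ?_
    rw [show j + (M + 1) = k by omega, inv_pow, hξ.pow_half_eq_neg_one hk]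
    norm_num
  have hpp : ξ ^ j * ξ⁻¹ ^ j = 1 := by rw [← mul_pow, mul_inv_cancel₀ h0, one_pow]
  have hdiv : -ξ ^ j / ξ⁻¹ = -ξ ^ (j + 1) := by rw [div_inv_eq_mul]; ring
  have hR : ∑ m ∈ Finset.range (M + 1),
      (-ξ ^ (j + 1)) ^ m * ∏ i ∈ Finset.range m, (1 + ξ⁻¹ ^ (j + (i + 1))) =
      1 + -ξ ^ (j + 1) * (1 + ξ⁻¹ ^ (j + 1)) * rootSum k ξ (j + 1) := by
    rw [Finset.sum_range_succ', rootSum, hM', Finset.mul_sum, add_comm]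
    congr 1
    · simp
    · refine Finset.sum_congr rfl fun m _ => ?_
      rw [Finset.prod_range_succ']
      have : ∀ i, j + (i + 1 + 1) = j + 1 + (i + 1) := fun i => by ring
      simp only [this]
      ring
  simp only [hprod, hdiv, hM, hzero, hR] at h1
  have hL : rootSum k ξ j = ∑ m ∈ Finset.range (M + 1),
      (-ξ ^ j) ^ m * ∏ i ∈ Finset.range m, (1 + ξ⁻¹ ^ (j + (i + 1))) := by rw [rootSum, hM]
  rw [← hL] at h1
  have hpp' : ξ ^ (j + 1) * ξ⁻¹ ^ (j + 1) = 1 := by rw [← mul_pow, mul_inv_cancel₀ h0, one_pow]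
  linear_combination h1 - rootSum k ξ j * hpp +
    (1 + ξ ^ (j + 1)) * rootSum k ξ (j + 1) * hpp'

lemma rootSum_zero {k : ℕ} (hk : 1 ≤ k) {ξ : ℂ} (hξ : IsPrimitiveRoot ξ (2 * k)) :
    rootSum k ξ 0 = -∑ n ∈ Finset.range k, qPoch (-ξ) ξ n ^ 2 * ξ ^ (n + 1) := by
  have h : ∀ N ≤ k, rootSum k ξ 0 =
      -∑ n ∈ Finset.range N, qPoch (-ξ) ξ n ^ 2 * ξ ^ (n + 1) +
        qPoch (-ξ) ξ N ^ 2 * rootSum k ξ N := by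
    intro N
    induction N with
    | zero => simp [qPoch]
    | succ N ih =>
      intro hN
      rw [ih (by omega), rootSum_step hk hξ (show N < k by omega), Finset.sum_range_succ]
      have : qPoch (-ξ) ξ (N + 1) = qPoch (-ξ) ξ N * (1 + ξ ^ (N + 1)) := by
        unfold qPoch; rw [Finset.prod_range_succ]; ring
      rw [this]
      ring
  rw [h k le_rfl]
  simp [rootSum]

lemma rootValue_eq {k : ℕ} (hk : 1 ≤ k) {ξ : ℂ} (hξ : IsPrimitiveRoot ξ (2 * k)) :
    rootValue k ξ (2 * k) = -2 * ∑ n ∈ Finset.range k, qPoch (-ξ) ξ n ^ 2 * ξ ^ (n + 1) := by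
  obtain ⟨n, rfl⟩ := Nat.exists_eq_add_of_le' hk
  rw [show 2 * (n + 1) = n + 1 + 1 + n by ring, rootValue_add hk hξ]
  have := rootSum_zero hk hξ
  rw [neg_mul, ← mul_neg, ← this, rootSum]
  congr 1
  refine Finset.sum_congr (by simp) fun m hm => ?_
  rw [pow_zero]
  congr 1
  refine Finset.prod_congr rfl fun i hi => ?_
  rw [Finset.mem_range] at hm hi
  congr 1
  rw [inv_pow]
  refine eq_inv_of_mul_eq_one_left ?_
  rw [← pow_add, show n + 1 + n - i + (0 + (i + 1)) = 2 * (n + 1) by omega, hξ.pow_eq_one]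

/-- Radial limit of Ramanujan's f at even-order roots of unity (Folsom–Ono–Rhoades). -/
theorem statement0 (k : ℕ) (hk : 1 ≤ k) (ξ : ℂ) (hξ : IsPrimitiveRoot ξ (2 * k)) :
    Filter.Tendsto
      (fun t : ℝ => mockf (ξ * Complex.exp (-(t : ℂ))) -
        (-1 : ℂ) ^ k * bfun (ξ * Complex.exp (-(t : ℂ))))
      (𝓝[>] (0 : ℝ))
      (𝓝 (-4 * ∑ n ∈ Finset.range k, qPoch (-ξ) ξ n ^ 2 * ξ ^ (n + 1))) := by
  have hξn : ‖ξ‖ = 1 := hξ.norm'_eq_one (by omega)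
  have hexp : ∀ t : ℝ, Complex.exp (-(t : ℂ)) = (Real.exp (-t) : ℂ) := fun t => by push_cast; rfl
  have hpath : Tendsto (fun t : ℝ => ξ * Complex.exp (-(t : ℂ))) (𝓝[>] 0)
      (𝓝[{q | ∃ r : ℝ, 0 ≤ r ∧ r ≤ 1 ∧ q = ξ * r}] ξ) := by
    refine tendsto_nhdsWithin_iff.mpr ⟨?_, ?_⟩
    · have : Continuous fun t : ℝ => ξ * Complex.exp (-(t : ℂ)) := by fun_prop
      simpa using (this.tendsto 0).mono_left nhdsWithin_le_nhds
    · filter_upwards [self_mem_nhdsWithin] with t ht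
      exact ⟨Real.exp (-t), (Real.exp_pos _).le,
        Real.exp_le_one_iff.mpr (neg_nonpos.mpr (le_of_lt ht)), by rw [hexp]⟩
  have hlt : ∀ᶠ t : ℝ in 𝓝[>] 0, ‖ξ * Complex.exp (-(t : ℂ))‖ < 1 := by
    filter_upwards [self_mem_nhdsWithin] with t ht
    rw [hexp, norm_mul, hξn, one_mul, Complex.norm_real, Real.norm_of_nonneg (Real.exp_pos _).le]
    exact Real.exp_lt_one_iff.mpr (neg_lt_zero.mpr ht)
  have hval := rootValue_eq hk hξ
  rcases Nat.even_or_odd k with hk2 | hk2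
  · have hl := (tendsto_oddSeries_root hk hξ (e := 0) (by simpa using hk2)).comp hpath
    have he : Even (2 * k + k) := (even_two_mul k).add hk2
    rw [rootValue, if_pos he, hξ.pow_eq_one] at hval
    rw [pow_zero] at hl
    have hgoal : (-4 : ℂ) * ∑ n ∈ Finset.range k, qPoch (-ξ) ξ n ^ 2 * ξ ^ (n + 1) =
        4 * oddSeries (-1) ξ := by linear_combination -2 * hval
    rw [hgoal]
    refine (hl.const_mul 4).congr' ?_
    filter_upwards [hlt] with t ht
    rw [hk2.neg_one_pow, one_mul, mockf_sub_bfun ht]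
    simp
  · have hl := (tendsto_oddSeries_root hk hξ (e := 1) (by
      rw [add_comm]; exact hk2.add_one)).comp hpath
    have he : Even (2 * k + 1 + k) := by
      obtain ⟨c, hc⟩ := hk2; exact ⟨3 * c + 2, by omega⟩
    have hs := rootValue_succ hk hξ (j := 2 * k) (by omega)
    rw [hval, rootValue, if_pos he, pow_succ, hξ.pow_eq_one, one_mul] at hs
    rw [pow_one] at hl
    have hgoal : (-4 : ℂ) * ∑ n ∈ Finset.range k, qPoch (-ξ) ξ n ^ 2 * ξ ^ (n + 1) =
        2 - 2 * oddSeries (-ξ) ξ := by linear_combination hs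
    rw [hgoal]
    refine ((hl.const_mul 2).const_sub 2).congr' ?_
    filter_upwards [hlt] with t ht
    rw [hk2.neg_one_pow, neg_one_mul, sub_neg_eq_add, mockf_add_bfun ht]
    simp

end
end

section
/- There exists an integer j ≥ 0 with ζ_b^a ζ_k^{h(A+Bj)} = 1 or ζ_b^{−a} ζ_k^{h(B−A+Bj)} = 1 (i.e., the infinite product (ζ_b^aζ_k^{hA};ζ_k^{hB})_∞ (ζ_b^{−a}ζ_k^{h(B−A)};ζ_k^{hB})_∞ has a vanishing factor) if and only if b ∣ k and gcd(B,k) ∣ (a(k/b) + hA). Moreover, if this is the case, then for every n ∈ ℕ one has #{j ∈ {0,…,n} : ζ_b^aζ_k^{h(A+Bj)} = 1} + #{j ∈ {0,…,n} : ζ_b^{−a}ζ_k^{h(B−A+Bj)} = 1} ≥ ⌊(2n+2)/k'⌋. -/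
open scoped BigOperators Classical
open Filter Topology

noncomputable section

theorem zeta_mul_zeta_eq_one_iff (m m' : ℤ) {b k : ℕ} (hb : 1 ≤ b) (hk : 1 ≤ k) :
    zeta m b * zeta m' k = 1 ↔ (b * k : ℤ) ∣ m * k + m' * b := by
  have hb0 : (b : ℂ) ≠ 0 := Nat.cast_ne_zero.mpr (by omega)
  have hk0 : (k : ℂ) ≠ 0 := Nat.cast_ne_zero.mpr (by omega)
  have hpi : (2 * Real.pi * Complex.I : ℂ) ≠ 0 := Complex.two_pi_I_ne_zero
  rw [zeta, zeta, ee, ee, ← Complex.exp_add, ← mul_add, Complex.exp_eq_one_iff]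
  refine exists_congr fun n => ?_
  rw [mul_comm (n : ℂ), mul_right_inj' hpi, div_add_div _ _ hb0 hk0,
    div_eq_iff (mul_ne_zero hb0 hk0), ← @Int.cast_inj ℂ]
  push_cast
  rw [mul_comm (m' : ℂ), mul_comm (n : ℂ)]

theorem mul_dvd_mul_add_mul_iff {a b k : ℕ} {s m : ℤ} (hs : IsUnit s) (hb : 1 ≤ b)
    (hab : Nat.gcd a b = 1) :
    (b * k : ℤ) ∣ s * a * k + m * b ↔ b ∣ k ∧ (k : ℤ) ∣ s * (a * (k / b : ℕ)) + m := by
  have hb0 : (b : ℤ) ≠ 0 := by exact_mod_cast (by omega : b ≠ 0)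
  have of_dvd (h : b ∣ k) : (b * k : ℤ) ∣ s * a * k + m * b ↔
      (k : ℤ) ∣ s * (a * (k / b : ℕ)) + m := by
    obtain ⟨l, rfl⟩ := h
    rw [Nat.mul_div_cancel_left l (by omega)]
    rw [← mul_dvd_mul_iff_left hb0 (b := ((b * l : ℕ) : ℤ))]
    push_cast
    ring_nf
  refine ⟨fun h => ?_, fun h => (of_dvd h.1).2 h.2⟩
  have hbk : b ∣ k := by
    have h1 : (b : ℤ) ∣ s * a * k :=
      (dvd_add_left (Dvd.intro_left m rfl)).1 ((Dvd.intro _ rfl).trans h)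
    rw [mul_assoc, hs.dvd_mul_left] at h1
    exact (Nat.Coprime.symm hab).dvd_of_dvd_mul_left (by exact_mod_cast h1)
  exact ⟨hbk, (of_dvd hbk).1 h⟩

theorem dvd_add_mul_iff_modEq {B h k : ℕ} (hB : 1 ≤ B) (hhk : Nat.gcd h k = 1) {c r : ℤ}
    (hr : (k : ℤ) ∣ c + h * B * r) (m : ℤ) :
    (k : ℤ) ∣ c + h * B * m ↔ m ≡ r [ZMOD (k / Nat.gcd k B : ℕ)] := by
  have hg : 0 < Nat.gcd k B := Nat.gcd_pos_of_pos_right _ hB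
  have hcop : Nat.Coprime (k / Nat.gcd k B) (B / Nat.gcd k B) := Nat.coprime_div_gcd_div_gcd hg
  have hkh : IsCoprime (k : ℤ) h := (Nat.isCoprime_iff_coprime.2 hhk).symm
  have hg0 : ((Nat.gcd k B : ℕ) : ℤ) ≠ 0 := by exact_mod_cast hg.ne'
  have hk' : (k : ℤ) = Nat.gcd k B * (k / Nat.gcd k B : ℕ) := by
    exact_mod_cast (Nat.mul_div_cancel' (Nat.gcd_dvd_left k B)).symm
  have hB' : (B : ℤ) = Nat.gcd k B * (B / Nat.gcd k B : ℕ) := by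
    exact_mod_cast (Nat.mul_div_cancel' (Nat.gcd_dvd_right k B)).symm
  have key : (k : ℤ) ∣ B * (r - m) ↔ ((k / Nat.gcd k B : ℕ) : ℤ) ∣ r - m := by
    have : (k : ℤ) ∣ B * (r - m) ↔ ((Nat.gcd k B : ℕ) : ℤ) * (k / Nat.gcd k B : ℕ) ∣
        (Nat.gcd k B : ℕ) * ((B / Nat.gcd k B : ℕ) * (r - m)) := by
      rw [← mul_assoc, ← hk', ← hB']
    rw [this, mul_dvd_mul_iff_left hg0]
    exact ⟨(Nat.isCoprime_iff_coprime.2 hcop).dvd_of_dvd_mul_left, fun h => h.mul_left _⟩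
  rw [Int.modEq_iff_dvd, ← key]
  have hsplit : c + h * B * r = c + h * B * m + h * (B * (r - m)) := by ring
  rw [hsplit] at hr
  exact ⟨fun hm => hkh.dvd_of_dvd_mul_left ((dvd_add_right hm).1 hr),
    fun hm => (dvd_add_left (hm.mul_left _)).1 hr⟩

theorem exists_dvd_add_mul {B h k : ℕ} (hhk : Nat.gcd h k = 1) {c : ℤ}
    (hc : (Nat.gcd B k : ℤ) ∣ c) : ∃ r : ℤ, (k : ℤ) ∣ c + h * B * r := by
  have hg : (Nat.gcd (h * B) k : ℤ) ∣ c := by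
    rwa [Nat.Coprime.gcd_mul_left_cancel B hhk]
  obtain ⟨l, hl⟩ := hg
  rw [Nat.gcd_eq_gcd_ab] at hl
  refine ⟨-(Nat.gcdA (h * B) k * l), Nat.gcdB (h * B) k * l, ?_⟩
  rw [hl]
  push_cast
  ring

theorem Int.div_le_card_Ico_filter_modEq {q : ℕ} (hq : 0 < q) (x r : ℤ) (N : ℕ) :
    N / q ≤ ((Finset.Ico x (x + N)).filter (fun m => m ≡ r [ZMOD q])).card := by
  have hq' : (0 : ℤ) < q := by exact_mod_cast hq
  have hqQ : (0 : ℚ) < q := by exact_mod_cast hq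
  have hcard := Int.Ico_filter_modEq_card x (x + N) hq' r
  zify
  refine le_trans ?_ (hcard.symm ▸ le_max_left _ _)
  rw [le_sub_iff_add_le', ← Int.ceil_add_intCast]
  refine Int.ceil_mono ?_
  have hdiv : ((N / q : ℤ) : ℚ) * q ≤ N := by exact_mod_cast Nat.div_mul_le_self N q
  push_cast at hdiv ⊢
  rw [div_add' _ _ _ hqQ.ne', div_le_div_iff_of_pos_right hqQ]
  linarith

/-- Zeros in the denominator of g₂ (Lemma 3.1). -/
theorem statement1 (a b A B h k : ℕ) (hb : 1 ≤ b) (hB : 1 ≤ B) (hk : 1 ≤ k)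
    (hab : a < b) (hAB : A < B) (hhk : h < k)
    (hgab : Nat.gcd a b = 1) (hgAB : Nat.gcd A B = 1) (hghk : Nat.gcd h k = 1) :
    ((∃ j : ℕ,
        zeta a b * zeta ((h : ℤ) * ((A : ℤ) + (B : ℤ) * (j : ℤ))) k = 1 ∨
        zeta (-(a : ℤ)) b * zeta ((h : ℤ) * ((B : ℤ) - (A : ℤ) + (B : ℤ) * (j : ℤ))) k = 1)
      ↔ (b ∣ k ∧ Nat.gcd B k ∣ (a * (k / b) + h * A))) ∧
    ((b ∣ k ∧ Nat.gcd B k ∣ (a * (k / b) + h * A)) → ∀ n : ℕ,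
      (2 * n + 2) / (k / Nat.gcd k B) ≤
        ((Finset.range (n + 1)).filter
          (fun j => zeta a b * zeta ((h : ℤ) * ((A : ℤ) + (B : ℤ) * (j : ℤ))) k = 1)).card +
        ((Finset.range (n + 1)).filter
          (fun j => zeta (-(a : ℤ)) b * zeta ((h : ℤ) * ((B : ℤ) - (A : ℤ) + (B : ℤ) * (j : ℤ))) k = 1)).card) := by
  have first (j : ℤ) : zeta a b * zeta ((h : ℤ) * ((A : ℤ) + (B : ℤ) * j)) k = 1 ↔
      b ∣ k ∧ (k : ℤ) ∣ (a * (k / b) + h * A : ℕ) + h * B * j := by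
    have := mul_dvd_mul_add_mul_iff (k := k) (m := h * (A + B * j)) isUnit_one hb hgab
    rw [one_mul] at this
    rw [zeta_mul_zeta_eq_one_iff _ _ hb hk, this]
    push_cast
    ring_nf
  have second (j : ℤ) :
      zeta (-(a : ℤ)) b * zeta ((h : ℤ) * ((B : ℤ) - (A : ℤ) + (B : ℤ) * j)) k = 1 ↔
      b ∣ k ∧ (k : ℤ) ∣ (a * (k / b) + h * A : ℕ) + h * B * (-j - 1) := by
    have := mul_dvd_mul_add_mul_iff (k := k) (m := h * (B - A + B * j)) isUnit_one.neg hb hgab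
    rw [neg_one_mul] at this
    rw [zeta_mul_zeta_eq_one_iff _ _ hb hk, this, ← dvd_neg (a := (k : ℤ))]
    push_cast
    ring_nf
  simp only [first, second]
  have hgB : (Nat.gcd B k : ℤ) ∣ B := by exact_mod_cast Nat.gcd_dvd_left B k
  have hgk : (Nat.gcd B k : ℤ) ∣ k := by exact_mod_cast Nat.gcd_dvd_right B k
  have gcd_dvd {m : ℤ} (hm : (k : ℤ) ∣ (a * (k / b) + h * A : ℕ) + h * B * m) :
      Nat.gcd B k ∣ a * (k / b) + h * A :=
    Int.natCast_dvd_natCast.1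
      ((dvd_add_left ((hgB.mul_left _).mul_right _)).1 (hgk.trans hm))
  refine ⟨⟨?_, ?_⟩, ?_⟩
  · rintro ⟨j, ⟨hbk, hj⟩ | ⟨hbk, hj⟩⟩ <;> exact ⟨hbk, gcd_dvd hj⟩
  · rintro ⟨hbk, hg⟩
    obtain ⟨r, hr⟩ := exists_dvd_add_mul hghk (Int.natCast_dvd_natCast.2 hg)
    obtain ⟨j, rfl | hj⟩ : ∃ j : ℕ, r = j ∨ r = -(j : ℤ) - 1 := by
      rcases le_or_gt 0 r with h0 | h0
      · exact ⟨r.toNat, by omega⟩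
      · exact ⟨(-r - 1).toNat, by omega⟩
    · exact ⟨j, Or.inl ⟨hbk, hr⟩⟩
    · exact ⟨j, Or.inr ⟨hbk, hj ▸ hr⟩⟩
  · rintro ⟨hbk, hg⟩ n
    obtain ⟨r, hr⟩ := exists_dvd_add_mul hghk (Int.natCast_dvd_natCast.2 hg)
    simp only [hbk, true_and, dvd_add_mul_iff_modEq hB hghk hr]
    have mem_cast (j : ℤ) :
        (j ∈ do let a ← Finset.range (n + 1); pure (a : ℤ)) ↔ 0 ≤ j ∧ j ≤ n := by
      simp only [Finset.bind_def, Finset.pure_def, Finset.mem_sup, Finset.mem_range,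
        Finset.mem_singleton]
      exact ⟨by rintro ⟨i, hi, rfl⟩; omega, fun hj => ⟨j.toNat, by omega, by omega⟩⟩
    set q := k / Nat.gcd k B
    have hq : 0 < q := Nat.div_pos (Nat.gcd_le_left _ hk) (Nat.gcd_pos_of_pos_left _ hk)
    refine (Int.div_le_card_Ico_filter_modEq hq (-(n : ℤ) - 1) r (2 * n + 2)).trans ?_
    refine le_trans ?_ (add_le_add_right (Finset.card_image_le (f := fun j : ℤ => -j - 1)) _)
    refine (Finset.card_le_card fun m hm => ?_).trans (Finset.card_union_le _ _)
    simp only [Finset.mem_filter, Finset.mem_Ico] at hm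
    simp only [Finset.mem_union, Finset.mem_image, Finset.mem_filter, mem_cast]
    obtain ⟨⟨hlo, hhi⟩, hmod⟩ := hm
    rcases le_or_gt 0 m with h0 | h0
    · exact Or.inl ⟨by omega, hmod⟩
    · have hm' : -(-m - 1) - 1 = m := by ring
      exact Or.inr ⟨-m - 1, ⟨by omega, hm'.symm ▸ hmod⟩, hm'⟩

end
end

section
/- Assume h/k ∈ 𝒬_{a,b,A,B}. Then for every n ∈ ℕ one has α_n ≥ β_n + ⌊n/k'⌋, where α_n := #{j ∈ {0,…,n} : ζ_b^aζ_k^{h(A+Bj)} = 1} + #{j ∈ {0,…,n} : ζ_b^{−a}ζ_k^{h(B−A+Bj)} = 1} is the order of vanishing of the denominator Pochhammer product (ζ_b^aζ_k^{hA};ζ_k^{hB})_{n+1}(ζ_b^{−a}ζ_k^{h(B−A)};ζ_k^{hB})_{n+1} of the n-th term of g₂, and β_n := #{m ∈ {1,…,n} : ζ_k^{hBm} = −1} is the order of vanishing of the numerator (−ζ_k^{hB};ζ_k^{hB})_n. In particular α_n > β_n for all n ≥ k', so the zeros in the numerator never cancel all zeros of the denominator. -/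
open scoped BigOperators Classical
open Filter Topology

noncomputable section

theorem zeta_eq_one_of_dvd {m : ℤ} {k : ℕ} (hk : 1 ≤ k) (h : (k : ℤ) ∣ m) : zeta m k = 1 := by
  obtain ⟨t, rfl⟩ := h
  have hk' : (k : ℂ) ≠ 0 := Nat.cast_ne_zero.mpr (by lia)
  unfold zeta ee
  rw [Complex.exp_eq_one_iff]
  refine ⟨t, ?_⟩
  push_cast
  field_simp

theorem exists_odd_mul_of_zeta_eq_neg_one {m : ℤ} {k : ℕ} (hk : 1 ≤ k) (h : zeta m k = -1) :
    ∃ t : ℤ, 2 * m = k * (2 * t + 1) := by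
  have hk' : (k : ℂ) ≠ 0 := Nat.cast_ne_zero.mpr (by lia)
  unfold zeta ee at h
  rw [← Complex.exp_pi_mul_I, Complex.exp_eq_exp_iff_exists_int] at h
  obtain ⟨t, ht⟩ := h
  refine ⟨t, ?_⟩
  have hpi : (Real.pi : ℂ) * Complex.I ≠ 0 :=
    mul_ne_zero (Complex.ofReal_ne_zero.mpr Real.pi_ne_zero) Complex.I_ne_zero
  have h2 : 2 * ((m : ℂ) / k) = 2 * t + 1 := by
    apply mul_left_cancel₀ hpi
    linear_combination ht
  have h3 : 2 * (m : ℂ) = k * (2 * t + 1) := by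
    rw [← h2]
    field_simp
  exact_mod_cast h3

theorem zeta_mul_zeta (x y : ℤ) {b d : ℕ} (hb : 1 ≤ b) (hd : 1 ≤ d) :
    zeta x b * zeta y (b * d) = zeta (x * d + y) (b * d) := by
  have hb' : (b : ℂ) ≠ 0 := Nat.cast_ne_zero.mpr (by lia)
  have hd' : (d : ℂ) ≠ 0 := Nat.cast_ne_zero.mpr (by lia)
  unfold zeta ee
  rw [← Complex.exp_add]
  congr 1
  push_cast
  field_simp

theorem card_filter_range_modEq {K : ℕ} (hK : 0 < K) (v n : ℕ) :
    ((Finset.range n).filter (fun j => j ≡ v [MOD K])).card =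
      n / K + if v % K < n % K then 1 else 0 := by
  rw [← Nat.count_modEq_card n hK v, Nat.count_eq_card_filter_range]

theorem card_filter_bind_intCast (s : Finset ℕ) (p : ℤ → Prop) :
    ((do let a ← s; pure (a : ℤ) : Finset ℤ).filter p).card =
      (s.filter (fun j : ℕ => p j)).card := by
  have hs : (do let a ← s; pure (a : ℤ) : Finset ℤ) = s.map Nat.castEmbedding := by
    ext x
    simp [Finset.bind_def, eq_comm]
  rw [hs, Finset.filter_map, Finset.card_map]
  rfl

/-- Solutions of two complementary congruences modulo `K` in `{0, …, n}` outnumber those of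
`2 * c * m = K * odd` in `{1, …, n}` by at least `n / K`. -/
theorem card_filter_add_div_le {K : ℕ} (hK : 0 < K) {r : ℕ} (hr : r < K) {c : ℤ}
    (hc : IsCoprime c (K : ℤ)) {p₁ p₂ p₃ : ℕ → Prop}
    (h₁ : ∀ j, j ≡ r [MOD K] → p₁ j) (h₂ : ∀ j, j ≡ K - 1 - r [MOD K] → p₂ j)
    (h₃ : ∀ m, p₃ m → ∃ t : ℤ, 2 * (c * m) = K * (2 * t + 1)) (n : ℕ) :
    ((Finset.Icc 1 n).filter p₃).card + n / K ≤
      ((Finset.range (n + 1)).filter p₁).card + ((Finset.range (n + 1)).filter p₂).card := by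
  have e₁ := Finset.card_le_card
    (Finset.monotone_filter_right (Finset.range (n + 1)) (fun j _ hj => h₁ j hj))
  have e₂ := Finset.card_le_card
    (Finset.monotone_filter_right (Finset.range (n + 1)) (fun j _ hj => h₂ j hj))
  rw [card_filter_range_modEq hK] at e₁ e₂
  rw [Nat.mod_eq_of_lt hr] at e₁
  rw [Nat.mod_eq_of_lt (show K - 1 - r < K by lia)] at e₂
  have e₄ : n / K ≤ (n + 1) / K := Nat.div_le_div_right (by lia)
  rcases Nat.even_or_odd' K with ⟨L, hL | hL⟩
  · have e₃ : ((Finset.Icc 1 n).filter p₃).card ≤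
        ((Finset.range (n + 1)).filter (fun j => j ≡ L [MOD K])).card := by
      apply Finset.card_le_card
      intro m hm
      simp only [Finset.mem_filter, Finset.mem_Icc, Finset.mem_range] at hm ⊢
      refine ⟨by lia, ?_⟩
      obtain ⟨t, ht⟩ := h₃ m hm.2
      have hKL : (K : ℤ) = 2 * L := by exact_mod_cast hL
      have hcm : c * m = L * (2 * t + 1) := by rw [hKL] at ht; linarith
      have hodd : Odd c := by
        rcases Int.even_or_odd c with ⟨s, hs⟩ | h
        · exfalso
          obtain ⟨u, v, huv⟩ := hc
          rw [hKL, hs] at huv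
          have : 2 * (u * s + v * L) = 1 := by linarith
          lia
        · exact h
      obtain ⟨s, hs⟩ := hodd
      have hdvd : (K : ℤ) ∣ c * ((L : ℤ) - m) := by
        refine ⟨s - t, ?_⟩
        rw [mul_sub, hcm, hKL, hs]
        ring
      rw [← Int.natCast_modEq_iff, Int.modEq_iff_dvd]
      exact hc.symm.dvd_of_dvd_mul_left hdvd
    rw [card_filter_range_modEq hK, Nat.mod_eq_of_lt (show L < K by lia)] at e₃
    split_ifs at e₁ e₂ e₃ <;> lia
  · have e₃ : ((Finset.Icc 1 n).filter p₃).card = 0 := by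
      rw [Finset.card_eq_zero, Finset.filter_eq_empty_iff]
      intro m _ hm
      obtain ⟨t, ht⟩ := h₃ m hm
      have hKL : (K : ℤ) = 2 * L + 1 := by exact_mod_cast hL
      have : 2 * (c * m - 2 * L * t - L - t) = 1 := by rw [hKL] at ht; linarith
      lia
    lia

/-- Proposition 3.2: numerator zeros never cancel denominator zeros. -/
theorem statement3 (a b A B h k : ℕ) (hb : 1 ≤ b) (hB : 1 ≤ B) (hk : 1 ≤ k)
    (hab : a < b) (hAB : A < B) (hhk : h < k)
    (hgab : Nat.gcd a b = 1) (hgAB : Nat.gcd A B = 1) (hghk : Nat.gcd h k = 1)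
    (hQ : b ∣ k ∧ Nat.gcd B k ∣ (a * (k / b) + h * A)) :
    (∀ n : ℕ,
      ((Finset.Icc 1 n).filter
          (fun m => zeta ((h : ℤ) * (B : ℤ) * (m : ℤ)) k = -1)).card +
        n / (k / Nat.gcd k B) ≤
      ((Finset.range (n + 1)).filter
          (fun j => zeta a b * zeta ((h : ℤ) * ((A : ℤ) + (B : ℤ) * (j : ℤ))) k = 1)).card +
      ((Finset.range (n + 1)).filter
          (fun j => zeta (-(a : ℤ)) b * zeta ((h : ℤ) * ((B : ℤ) - (A : ℤ) + (B : ℤ) * (j : ℤ))) k = 1)).card) ∧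
    (∀ n : ℕ, k / Nat.gcd k B ≤ n →
      ((Finset.Icc 1 n).filter
          (fun m => zeta ((h : ℤ) * (B : ℤ) * (m : ℤ)) k = -1)).card <
      ((Finset.range (n + 1)).filter
          (fun j => zeta a b * zeta ((h : ℤ) * ((A : ℤ) + (B : ℤ) * (j : ℤ))) k = 1)).card +
      ((Finset.range (n + 1)).filter
          (fun j => zeta (-(a : ℤ)) b * zeta ((h : ℤ) * ((B : ℤ) - (A : ℤ) + (B : ℤ) * (j : ℤ))) k = 1)).card) := by
  have key : ∀ n : ℕ,
      ((Finset.Icc 1 n).filter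
          (fun m : ℕ => zeta ((h : ℤ) * (B : ℤ) * (m : ℤ)) k = -1)).card +
        n / (k / Nat.gcd k B) ≤
      ((Finset.range (n + 1)).filter
          (fun j : ℕ => zeta a b * zeta ((h : ℤ) * ((A : ℤ) + (B : ℤ) * (j : ℤ))) k = 1)).card +
      ((Finset.range (n + 1)).filter
          (fun j : ℕ => zeta (-(a : ℤ)) b *
            zeta ((h : ℤ) * ((B : ℤ) - (A : ℤ) + (B : ℤ) * (j : ℤ))) k = 1)).card := by
    obtain ⟨⟨d, hd⟩, hc⟩ := hQ
    have hd1 : 1 ≤ d := by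
      rcases Nat.eq_zero_or_pos d with rfl | h0 <;> lia
    rw [Nat.gcd_comm, hd, Nat.mul_div_cancel_left d (by lia), ← hd] at hc
    have hg : 0 < Nat.gcd k B := Nat.gcd_pos_of_pos_left B hk
    obtain ⟨K, hKk⟩ := Nat.gcd_dvd_left k B
    obtain ⟨B', hB'⟩ := Nat.gcd_dvd_right k B
    have hcopB : Nat.Coprime K B' := by
      have := Nat.coprime_div_gcd_div_gcd hg
      rwa [Nat.div_eq_of_eq_mul_right hg hKk, Nat.div_eq_of_eq_mul_right hg hB'] at this
    rw [Nat.div_eq_of_eq_mul_right hg hKk]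
    generalize Nat.gcd k B = g at *
    obtain ⟨c, hc⟩ := hc
    have hK : 0 < K := by
      rcases Nat.eq_zero_or_pos K with rfl | h0 <;> lia
    have hcoph : Nat.Coprime h K := Nat.Coprime.coprime_dvd_right ⟨g, by rw [hKk, mul_comm]⟩ hghk
    have hcop : IsCoprime ((h : ℤ) * B') (K : ℤ) := by
      have := Nat.isCoprime_iff_coprime.mpr (hcoph.mul_left hcopB.symm)
      exact_mod_cast this
    obtain ⟨r, hr, hrc⟩ : ∃ r : ℕ, r < K ∧ (K : ℤ) ∣ c + h * B' * r := by
      obtain ⟨u, v, huv⟩ := hcop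
      have hK0 : (0 : ℤ) < K := by exact_mod_cast hK
      have hx := Int.emod_nonneg (-(u * c)) hK0.ne'
      have hx' := Int.emod_lt_of_pos (-(u * c)) hK0
      refine ⟨((-(u * c)) % K).toNat, by lia, ?_⟩
      rw [Int.toNat_of_nonneg hx]
      refine ⟨v * c - h * B' * (-(u * c) / K), ?_⟩
      have := Int.emod_add_mul_ediv (-(u * c)) K
      linear_combination (h * B' : ℤ) * this - (c : ℤ) * huv
    have hkZ : (k : ℤ) = g * K := by exact_mod_cast hKk
    have hBZ : (B : ℤ) = g * B' := by exact_mod_cast hB'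
    have hcZ : (a : ℤ) * d + h * A = g * c := by exact_mod_cast hc
    have hgZ : (g : ℤ) ≠ 0 := by exact_mod_cast hg.ne'
    refine card_filter_add_div_le hK hr hcop ?_ ?_ ?_
    · intro j hj
      obtain ⟨s, hs⟩ := (Nat.modEq_iff_dvd.mp hj.symm)
      obtain ⟨t, ht⟩ := hrc
      rw [hd, zeta_mul_zeta _ _ hb hd1, ← hd]
      refine zeta_eq_one_of_dvd hk ⟨t + h * B' * s, ?_⟩
      rw [hkZ, hBZ]
      linear_combination hcZ + (g : ℤ) * ht + (g * h * B' : ℤ) * hs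
    · intro j hj
      obtain ⟨s, hs⟩ := (Nat.modEq_iff_dvd.mp hj.symm)
      obtain ⟨t, ht⟩ := hrc
      have hsub : ((K - 1 - r : ℕ) : ℤ) = K - 1 - r := by lia
      rw [hsub] at hs
      rw [hd, zeta_mul_zeta _ _ hb hd1, ← hd]
      refine zeta_eq_one_of_dvd hk ⟨h * B' * (s + 1) - t, ?_⟩
      rw [hkZ, hBZ]
      linear_combination -hcZ - (g : ℤ) * ht + (g * h * B' : ℤ) * hs
    · intro m hm
      obtain ⟨t, ht⟩ := exists_odd_mul_of_zeta_eq_neg_one hk hm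
      refine ⟨t, mul_left_cancel₀ hgZ ?_⟩
      rw [hkZ, hBZ] at ht
      linear_combination ht
  simp only [card_filter_bind_intCast]
  refine ⟨key, fun n hn => ?_⟩
  have hpos : 0 < k / Nat.gcd k B :=
    Nat.div_pos (Nat.le_of_dvd hk (Nat.gcd_dvd_left k B)) (Nat.gcd_pos_of_pos_left B hk)
  have := Nat.div_pos hn hpos
  have := key n
  lia

end
end
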